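/- arXiv:2309.11498 — 4 statements merged into one kernel-verified Lean document; each statement's English description precedes it below -/
import Mathlib

section
/- For every positive integer n, the n-th constrained quantization error for P with respect to the family of constraints (S_j) equals V_n = (4n² + 12n + 13)/(24n²); that is, the infimum over all sets α ⊆ ⋃_{j=1}^n S_j with 1 ≤ card(α) ≤ n of ∫ min_{a∈α} ‖y − a‖² dP(y) equals (4n² + 12n + 13)/(24n²). -/
open MeasureTheory

noncomputable section

/-- The Euclidean plane ℝ². -/
abbrev Plane : Type := EuclideanSpace ℝ (Fin 2)

/-- The point (x, y) in the Euclidean plane. -/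
def pt (x y : ℝ) : Plane := (WithLp.equiv 2 (Fin 2 → ℝ)).symm ![x, y]

/-- P: the uniform probability measure on the segment J = [0,1] × {0}, i.e. the pushforward
of Lebesgue measure restricted to [0,1] under x ↦ (x, 0). -/
def P : Measure Plane :=
  Measure.map (fun x : ℝ => pt x 0) (volume.restrict (Set.Icc (0 : ℝ) 1))

/-- The constraint S_j = {(x, x + 1/j) : -1/j ≤ x ≤ 1}. -/
def S (j : ℕ) : Set Plane :=
  {p | ∃ x : ℝ, -(1 / (j : ℝ)) ≤ x ∧ x ≤ 1 ∧ p = pt x (x + 1 / (j : ℝ))}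

/-- min_{b ∈ β} ‖y - b‖², written as an infimum over the image set. -/
def minDist (β : Set Plane) (y : Plane) : ℝ :=
  sInf ((fun b => ‖y - b‖ ^ 2) '' β)

/-- The distortion error ∫ min_{b ∈ β} ‖y - b‖² dP(y) of a set β. -/
def distortion (β : Set Plane) : ℝ := ∫ y, minDist β y ∂P

/-- The n-th constrained quantization error for P with respect to the family (S_j). -/
def Vn (n : ℕ) : ℝ :=
  sInf {v : ℝ | ∃ α : Finset Plane,
    ↑α ⊆ (⋃ j ∈ Finset.Icc 1 n, S j) ∧ 1 ≤ α.card ∧ α.card ≤ n ∧ v = distortion ↑α}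

lemma norm_pt_sub_sq (t : ℝ) (b : Plane) :
    ‖pt t 0 - b‖ ^ 2 = (t - b 0) ^ 2 + b 1 ^ 2 := by
  simp [EuclideanSpace.norm_sq_eq, pt]

lemma continuous_pt_zero : Continuous fun t : ℝ => pt t 0 := by
  unfold pt
  refine (PiLp.continuous_toLp 2 _).comp (continuous_pi fun i => ?_)
  fin_cases i
  · exact continuous_id
  · exact continuous_const

lemma minDist_coe (α : Finset Plane) (hα : α.Nonempty) (y : Plane) :
    minDist α y = α.inf' hα fun b => ‖y - b‖ ^ 2 :=
  (Finset.inf'_eq_csInf_image α hα _).symm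

lemma continuous_minDist (α : Finset Plane) (hα : α.Nonempty) : Continuous (minDist α) := by
  rw [funext (minDist_coe α hα)]
  exact Continuous.finset_inf'_apply hα fun b _ => by fun_prop

lemma distortion_eq (α : Finset Plane) (hα : α.Nonempty) :
    distortion α = ∫ t in (0 : ℝ)..1, minDist α (pt t 0) := by
  rw [distortion, P, integral_map continuous_pt_zero.aemeasurable
    (continuous_minDist α hα).aestronglyMeasurable, integral_Icc_eq_integral_Ioc,
    intervalIntegral.integral_of_le zero_le_one]

/-- The squared distance to a point of the line `y = x + c` splits into the squared distance to the
line and half the squared distance between `t` and the point seen along the normal direction. -/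
lemma norm_pt_sub_pt_sq (t x c : ℝ) :
    ‖pt t 0 - pt x (x + c)‖ ^ 2 = (t + c) ^ 2 / 2 + (t - (2 * x + c)) ^ 2 / 2 := by
  rw [norm_pt_sub_sq]
  simp only [pt, WithLp.equiv_symm_apply, Matrix.cons_val_zero, Matrix.cons_val_one]
  ring

lemma le_norm_pt_sub_sq {n j : ℕ} (hj : 1 ≤ j) (hjn : j ≤ n) {b : Plane} (hb : b ∈ S j)
    {t : ℝ} (ht : 0 ≤ t) :
    (t + 1 / n) ^ 2 / 2 + (t - (b 0 + b 1)) ^ 2 / 2 ≤ ‖pt t 0 - b‖ ^ 2 := by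
  obtain ⟨x, -, -, rfl⟩ := hb
  have hc : (1 : ℝ) / n ≤ 1 / j :=
    one_div_le_one_div_of_le (by exact_mod_cast hj) (by exact_mod_cast hjn)
  have hsum : pt x (x + 1 / j) 0 + pt x (x + 1 / j) 1 = 2 * x + 1 / j := by
    simp only [pt, WithLp.equiv_symm_apply, Matrix.cons_val_zero, Matrix.cons_val_one]
    ring
  rw [norm_pt_sub_pt_sq, hsum]
  gcongr

lemma integral_max_sub_sq_le (u : ℝ) {h : ℝ} (hh : 0 ≤ h) :
    ∫ t in (0 : ℝ)..1, max (h ^ 2 - (t - u) ^ 2) 0 ≤ 4 * h ^ 3 / 3 := by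
  have hind : (fun t => max (h ^ 2 - (t - u) ^ 2) 0) =
      (Set.Icc (u - h) (u + h)).indicator fun t => h ^ 2 - (t - u) ^ 2 := by
    ext t
    by_cases ht : t ∈ Set.Icc (u - h) (u + h)
    · rw [Set.indicator_of_mem ht, max_eq_left]
      nlinarith [ht.1, ht.2]
    · rw [Set.indicator_of_notMem ht, max_eq_right]
      by_contra! hlt
      exact ht ⟨by nlinarith, by nlinarith⟩
  have hint : Integrable fun t => max (h ^ 2 - (t - u) ^ 2) 0 := by
    rw [hind, integrable_indicator_iff measurableSet_Icc]
    exact (by fun_prop : Continuous fun t : ℝ => h ^ 2 - (t - u) ^ 2).continuousOn.integrableOn_Icc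
  rw [intervalIntegral.integral_of_le zero_le_one]
  refine (setIntegral_le_integral hint (.of_forall fun t => le_max_right _ _)).trans_eq ?_
  rw [hind, integral_indicator measurableSet_Icc, integral_Icc_eq_integral_Ioc,
    ← intervalIntegral.integral_of_le (by linarith),
    intervalIntegral.integral_comp_sub_right (fun t => h ^ 2 - t ^ 2) u,
    intervalIntegral.integral_sub (by simp) (by simp), integral_pow]
  simp
  ring

lemma integral_add_sq_div_two (c : ℝ) :
    ∫ t in (0 : ℝ)..1, (t + c) ^ 2 / 2 = (1 + 3 * c + 3 * c ^ 2) / 6 := by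
  rw [intervalIntegral.integral_div, intervalIntegral.integral_comp_add_right (fun t => t ^ 2) c,
    integral_pow]
  norm_num
  ring

lemma le_distortion {n : ℕ} (hn : 1 ≤ n) (α : Finset Plane)
    (hsub : ↑α ⊆ ⋃ j ∈ Finset.Icc 1 n, S j) (hα : α.Nonempty) (hcard : α.card ≤ n) :
    (4 * (n : ℝ) ^ 2 + 12 * n + 13) / (24 * (n : ℝ) ^ 2) ≤ distortion α := by
  have hn0 : (0 : ℝ) < n := by exact_mod_cast hn
  set h : ℝ := 1 / (2 * n) with hh
  have hh0 : 0 ≤ h := by positivity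
  let f : Plane → ℝ → ℝ := fun b t => max (h ^ 2 - (t - (b 0 + b 1)) ^ 2) 0
  have hf : ∀ b, Continuous (f b) := fun b => by fun_prop
  have hpt : ∀ t ∈ Set.Icc (0 : ℝ) 1,
      (t + 1 / n) ^ 2 / 2 + (h ^ 2 - ∑ b ∈ α, f b t) / 2 ≤ minDist α (pt t 0) := by
    intro t ht
    rw [minDist_coe α hα, Finset.le_inf'_iff]
    intro b hb
    obtain ⟨j, hj, hbj⟩ := Set.mem_iUnion₂.1 (hsub hb)
    rw [Finset.mem_Icc] at hj
    have hdist := le_norm_pt_sub_sq hj.1 hj.2 hbj ht.1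
    have hle : f b t ≤ ∑ b ∈ α, f b t :=
      Finset.single_le_sum (f := fun b => f b t) (fun _ _ => le_max_right _ _) hb
    have hmax : h ^ 2 - (t - (b 0 + b 1)) ^ 2 ≤ f b t := le_max_left _ _
    linarith
  have hsum : ∑ b ∈ α, ∫ t in (0 : ℝ)..1, f b t ≤ n * (4 * h ^ 3 / 3) := by
    refine (Finset.sum_le_card_nsmul α _ _ fun b _ => integral_max_sub_sq_le _ hh0).trans ?_
    rw [nsmul_eq_mul]
    gcongr
  have hcont : Continuous fun t => ∑ b ∈ α, f b t := continuous_finsetSum α fun b _ => hf b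
  have hcont1 : Continuous fun t : ℝ => (t + 1 / (n : ℝ)) ^ 2 / 2 := by fun_prop
  have hcont2 : Continuous fun t => (h ^ 2 - ∑ b ∈ α, f b t) / 2 := by fun_prop
  rw [distortion_eq α hα]
  refine le_trans ?_ (intervalIntegral.integral_mono_on zero_le_one
    ((hcont1.add hcont2).intervalIntegrable 0 1)
    (((continuous_minDist α hα).comp continuous_pt_zero).intervalIntegrable 0 1) hpt)
  simp only [Pi.add_apply]
  rw [intervalIntegral.integral_add (hcont1.intervalIntegrable 0 1)
      (hcont2.intervalIntegrable 0 1), integral_add_sq_div_two, intervalIntegral.integral_div,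
    intervalIntegral.integral_sub intervalIntegrable_const (hcont.intervalIntegrable 0 1),
    intervalIntegral.integral_finsetSum fun b _ => (hf b).intervalIntegrable 0 1]
  have hval : (4 * (n : ℝ) ^ 2 + 12 * n + 13) / (24 * (n : ℝ) ^ 2) =
      (1 + 3 * (1 / (n : ℝ)) + 3 * (1 / (n : ℝ)) ^ 2) / 6 + (h ^ 2 - n * (4 * h ^ 3 / 3)) / 2 := by
    rw [hh]
    field_simp
    ring
  simp only [intervalIntegral.integral_const, sub_zero, one_smul]
  linarith

/-- The point of `S n` whose normal projection to the axis is the midpoint of `[k/n, (k+1)/n]`. -/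
def optimalPoint (n k : ℕ) : Plane :=
  pt ((2 * k - 1) / (4 * n)) ((2 * k - 1) / (4 * n) + 1 / n)

/-- An optimal set of `n` points. -/
def optimalSet (n : ℕ) : Finset Plane := (Finset.range n).image (optimalPoint n)

lemma optimalPoint_mem {n k : ℕ} (hk : k < n) : optimalPoint n k ∈ S n := by
  have hn0 : (0 : ℝ) < n := by exact_mod_cast (Nat.zero_le k).trans_lt hk
  have hk' : (k : ℝ) < n := by exact_mod_cast hk
  have hk0 : (0 : ℝ) ≤ k := k.cast_nonneg
  refine ⟨(2 * k - 1) / (4 * n), ?_, ?_, rfl⟩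
  · rw [← neg_div, div_le_div_iff₀ hn0 (by positivity)]
    nlinarith
  · rw [div_le_one (by positivity)]
    linarith

lemma integral_sub_midpoint_sq {n : ℕ} (hn : 1 ≤ n) (k : ℕ) :
    ∫ t in ((k : ℝ) / n)..((k + 1 : ℕ) : ℝ) / n,
      (t - (2 * ((2 * k - 1) / (4 * n)) + 1 / n)) ^ 2 / 2 = 1 / (24 * (n : ℝ) ^ 3) := by
  have hn0 : (n : ℝ) ≠ 0 := by exact_mod_cast (Nat.one_le_iff_ne_zero.1 hn)
  rw [intervalIntegral.integral_div,
    intervalIntegral.integral_comp_sub_right (fun t => t ^ 2), integral_pow]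
  push_cast
  field_simp
  ring

lemma distortion_optimalSet_le {n : ℕ} (hn : 1 ≤ n) :
    distortion (optimalSet n) ≤ (4 * (n : ℝ) ^ 2 + 12 * n + 13) / (24 * (n : ℝ) ^ 2) := by
  have hn0 : (0 : ℝ) < n := by exact_mod_cast hn
  have hα : (optimalSet n).Nonempty :=
    (Finset.nonempty_range_iff.2 (Nat.one_le_iff_ne_zero.1 hn)).image _
  let g : ℝ → ℝ := fun t => (t + 1 / (n : ℝ)) ^ 2 / 2
  let q : ℕ → ℝ → ℝ := fun k t => (t - (2 * ((2 * k - 1) / (4 * n)) + 1 / n)) ^ 2 / 2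
  have hg : Continuous g := by fun_prop
  have hq : ∀ k, Continuous (q k) := fun k => by fun_prop
  have hm : Continuous fun t => minDist (optimalSet n) (pt t 0) :=
    (continuous_minDist _ hα).comp continuous_pt_zero
  have hsplit : ∀ f : ℝ → ℝ, Continuous f → ∫ t in (0 : ℝ)..1, f t =
      ∑ k ∈ Finset.range n, ∫ t in ((k : ℝ) / n)..((k + 1 : ℕ) : ℝ) / n, f t := by
    intro f hf
    rw [intervalIntegral.sum_integral_adjacent_intervals (a := fun k : ℕ => (k : ℝ) / n)
      fun k _ => hf.intervalIntegrable _ _]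
    simp [hn0.ne']
  have hpiece : ∀ k ∈ Finset.range n,
      ∫ t in ((k : ℝ) / n)..((k + 1 : ℕ) : ℝ) / n, minDist (optimalSet n) (pt t 0) ≤
      (∫ t in ((k : ℝ) / n)..((k + 1 : ℕ) : ℝ) / n, g t) + 1 / (24 * (n : ℝ) ^ 3) := by
    intro k hk
    rw [← integral_sub_midpoint_sq hn k, ← intervalIntegral.integral_add
      (hg.intervalIntegrable _ _) ((hq k).intervalIntegrable _ _)]
    refine intervalIntegral.integral_mono_on (by gcongr; simp) (hm.intervalIntegrable _ _)
      ((hg.add (hq k)).intervalIntegrable _ _) fun t _ => ?_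
    rw [minDist_coe _ hα, ← norm_pt_sub_pt_sq]
    exact Finset.inf'_le (fun b => ‖pt t 0 - b‖ ^ 2) (Finset.mem_image_of_mem (optimalPoint n) hk)
  rw [distortion_eq _ hα, hsplit _ hm]
  refine (Finset.sum_le_sum hpiece).trans_eq ?_
  rw [Finset.sum_add_distrib, ← hsplit g hg, integral_add_sq_div_two, Finset.sum_const,
    Finset.card_range, nsmul_eq_mul]
  field_simp
  ring

/-- for every n ≥ 1, the n-th constrained quantization error equals
(4n² + 12n + 13)/(24n²). -/
theorem constrained_quantization_error_eq (n : ℕ) (hn : 1 ≤ n) :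
    Vn n = (4 * (n : ℝ) ^ 2 + 12 * n + 13) / (24 * (n : ℝ) ^ 2) := by
  have hlower : ∀ v ∈ {v : ℝ | ∃ α : Finset Plane,
      ↑α ⊆ (⋃ j ∈ Finset.Icc 1 n, S j) ∧ 1 ≤ α.card ∧ α.card ≤ n ∧ v = distortion ↑α},
      (4 * (n : ℝ) ^ 2 + 12 * n + 13) / (24 * (n : ℝ) ^ 2) ≤ v := by
    rintro v ⟨α, hsub, hpos, hcard, rfl⟩
    exact le_distortion hn α hsub (Finset.card_pos.1 hpos) hcard
  have hmem : distortion (optimalSet n) ∈ {v : ℝ | ∃ α : Finset Plane,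
      ↑α ⊆ (⋃ j ∈ Finset.Icc 1 n, S j) ∧ 1 ≤ α.card ∧ α.card ≤ n ∧ v = distortion ↑α} := by
    refine ⟨optimalSet n, fun b hb => ?_, ?_, ?_, rfl⟩
    · obtain ⟨k, hk, rfl⟩ := Finset.mem_image.1 (Finset.mem_coe.1 hb)
      exact Set.mem_iUnion₂.2
        ⟨n, Finset.mem_Icc.2 ⟨hn, le_rfl⟩, optimalPoint_mem (Finset.mem_range.1 hk)⟩
    · exact Finset.card_pos.2
        ((Finset.nonempty_range_iff.2 (Nat.one_le_iff_ne_zero.1 hn)).image _)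
    · exact Finset.card_image_le.trans_eq (Finset.card_range n)
  exact le_antisymm ((csInf_le ⟨_, hlower⟩ hmem).trans (distortion_optimalSet_le hn))
    (le_csInf ⟨_, hmem⟩ hlower)

end
end

section
/- For every positive integer n, the set α_n = { ( (1/2)((2j−1)/(2n) − 1/n), (1/2)((2j−1)/(2n) − 1/n) + 1/n ) : 1 ≤ j ≤ n } is contained in S_n, has cardinality n, and its distortion error satisfies ∫ min_{a∈α_n} ‖y − a‖² dP(y) = (4n² + 12n + 13)/(24n²). -/
open MeasureTheory

noncomputable section

theorem norm_pt_sub_pt_sq_s1 (a b c d : ℝ) :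
    ‖pt a b - pt c d‖ ^ 2 = (a - c) ^ 2 + (b - d) ^ 2 := by
  simp [pt, EuclideanSpace.norm_sq_eq, Fin.sum_univ_two]

theorem measurableEmbedding_pt_zero : MeasurableEmbedding fun x : ℝ => pt x 0 := by
  refine Isometry.isClosedEmbedding (Isometry.of_dist_eq fun x y => ?_) |>.measurableEmbedding
  rw [dist_eq_norm, Real.dist_eq, ← sq_eq_sq₀ (norm_nonneg _) (abs_nonneg _), norm_pt_sub_pt_sq_s1,
    sq_abs]
  ring

theorem distortion_eq_intervalIntegral (β : Set Plane) :
    distortion β = ∫ t in (0 : ℝ)..1, minDist β (pt t 0) := by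
  rw [distortion, P, measurableEmbedding_pt_zero.integral_map, integral_Icc_eq_integral_Ioc,
    intervalIntegral.integral_of_le zero_le_one]

/-- The quadratic expression for the squared distance from `(t, 0)` to the point of the line
`y = x + h` with first coordinate `(m - h) / 2`. -/
theorem norm_pt_zero_sub_pt_sq (t m h : ℝ) :
    ‖pt t 0 - pt ((1 / 2) * (m - h)) ((1 / 2) * (m - h) + h)‖ ^ 2 =
      (t + h) ^ 2 / 2 + (t - m) ^ 2 / 2 := by
  rw [norm_pt_sub_pt_sq_s1]
  ring

/-- In the `k`-th cell of the uniform partition of `[0, 1]`, the midpoint of that cell is the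
closest one among all midpoints. -/
theorem sq_sub_midpoint_le {n k j : ℕ} (hn : 1 ≤ n) {t : ℝ} (hk : (k : ℝ) / n ≤ t)
    (hk' : t ≤ ((k + 1 : ℕ) : ℝ) / n) :
    (t - (2 * ((k + 1 : ℕ) : ℝ) - 1) / (2 * n)) ^ 2 ≤ (t - (2 * (j : ℝ) - 1) / (2 * n)) ^ 2 := by
  have hn0 : (0 : ℝ) < n := by exact_mod_cast hn
  obtain ⟨u, rfl⟩ : ∃ u : ℝ, t = u / n := ⟨t * n, by field_simp⟩
  rw [div_le_div_iff_of_pos_right hn0] at hk hk'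
  push_cast at hk' ⊢
  have e (c : ℝ) : (u / n - (2 * c - 1) / (2 * n)) ^ 2 = (u - c + 1 / 2) ^ 2 / (n : ℝ) ^ 2 := by
    field_simp
    ring
  rw [e, e]
  gcongr ?_ / _
  rcases lt_trichotomy j (k + 1) with h | rfl | h
  · have h' : (j : ℝ) + 1 ≤ k + 1 := by exact_mod_cast h
    nlinarith
  · push_cast
    rfl
  · have h' : (k : ℝ) + 1 + 1 ≤ j := by exact_mod_cast h
    nlinarith

/-- the set α_n = {((1/2)((2j−1)/(2n) − 1/n), (1/2)((2j−1)/(2n) − 1/n) + 1/n) :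
1 ≤ j ≤ n} is contained in S_n, has cardinality n, and its distortion error equals
(4n² + 12n + 13)/(24n²). -/
theorem optimal_set_candidate (n : ℕ) (hn : 1 ≤ n) :
    letI : DecidableEq Plane := Classical.decEq _
    letI α : Finset Plane := (Finset.Icc 1 n).image
      (fun j : ℕ => pt ((1 / 2) * ((2 * (j : ℝ) - 1) / (2 * n) - 1 / n))
        ((1 / 2) * ((2 * (j : ℝ) - 1) / (2 * n) - 1 / n) + 1 / n))
    ↑α ⊆ S n ∧ α.card = n ∧
      distortion ↑α = (4 * (n : ℝ) ^ 2 + 12 * n + 13) / (24 * (n : ℝ) ^ 2) := by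
  let : DecidableEq Plane := Classical.decEq _
  have hn0 : (0 : ℝ) < n := by exact_mod_cast hn
  refine ⟨?_, ?_, ?_⟩
  · intro p hp
    obtain ⟨j, hj, rfl⟩ := Finset.mem_image.1 (Finset.mem_coe.1 hp)
    obtain ⟨hj1, hjn⟩ := Finset.mem_Icc.1 hj
    have h1 : (1 : ℝ) ≤ j := by exact_mod_cast hj1
    have h2 : (j : ℝ) ≤ n := by exact_mod_cast hjn
    have e : (1 / 2) * ((2 * (j : ℝ) - 1) / (2 * n) - 1 / n) = (2 * j - 3) / (4 * n) := by
      field_simp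
      ring
    refine ⟨_, ?_, ?_, rfl⟩
    · rw [e, ← neg_div, div_le_div_iff₀ (by positivity) (by positivity)]
      nlinarith
    · rw [e, div_le_one (by positivity)]
      linarith
  · rw [Finset.card_image_of_injective _ ?_, Nat.card_Icc, Nat.add_sub_cancel]
    intro i j hij
    have h0 := congrArg (fun p : Plane => p 0) hij
    simp only [pt, WithLp.equiv_symm_apply, Matrix.cons_val_zero] at h0
    field_simp at h0
    exact_mod_cast (by linarith : (i : ℝ) = j)
  · set α : Finset Plane := (Finset.Icc 1 n).image _
    let g : ℕ → ℝ → ℝ := fun k t =>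
      (t + 1 / n) ^ 2 / 2 + (t - (2 * ((k + 1 : ℕ) : ℝ) - 1) / (2 * n)) ^ 2 / 2
    have hle (k : ℕ) : (k : ℝ) / n ≤ ((k + 1 : ℕ) : ℝ) / n := by
      gcongr
      exact k.le_succ
    have hcell (k : ℕ) (hk : k < n) :
        Set.EqOn (g k) (fun t => minDist α (pt t 0))
          (Set.uIoc ((k : ℝ) / n) (((k + 1 : ℕ) : ℝ) / n)) := by
      intro t ht
      rw [Set.uIoc_of_le (hle k)] at ht
      refine (IsLeast.csInf_eq ⟨?_, ?_⟩).symm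
      · exact ⟨_, Finset.mem_coe.2 (Finset.mem_image_of_mem _
          (Finset.mem_Icc.2 ⟨k.succ_pos, hk⟩)), norm_pt_zero_sub_pt_sq _ _ _⟩
      · rintro _ ⟨p, hp, rfl⟩
        obtain ⟨j, -, rfl⟩ := Finset.mem_image.1 (Finset.mem_coe.1 hp)
        dsimp only
        rw [norm_pt_zero_sub_pt_sq]
        have := sq_sub_midpoint_le (j := j) hn ht.1.le ht.2
        simp only [g]
        linarith
    have hg (k : ℕ) : Continuous (g k) := by fun_prop
    have hval (k : ℕ) : ∫ t in ((k : ℝ) / n)..(((k + 1 : ℕ) : ℝ) / n), g k t =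
        (((((k + 1 : ℕ) : ℝ) + 1) ^ 3 - ((k : ℝ) + 1) ^ 3) / 6 + 1 / 24) / (n : ℝ) ^ 3 := by
      simp only [g]
      rw [intervalIntegral.integral_add
        (Continuous.intervalIntegrable (by fun_prop) _ _)
        (Continuous.intervalIntegrable (by fun_prop) _ _),
        intervalIntegral.integral_div, intervalIntegral.integral_div,
        intervalIntegral.integral_comp_add_right (fun t => t ^ 2),
        intervalIntegral.integral_comp_sub_right (fun t => t ^ 2), integral_pow, integral_pow]
      push_cast
      field_simp
      ring
    have hsum := intervalIntegral.sum_integral_adjacent_intervals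
      (f := fun t => minDist α (pt t 0)) (μ := volume) (a := fun k : ℕ => (k : ℝ) / n) (n := n)
      fun k hk => ((hg k).intervalIntegrable _ _).congr (hcell k hk)
    rw [Nat.cast_zero, zero_div, div_self hn0.ne'] at hsum
    rw [distortion_eq_intervalIntegral, ← hsum, Finset.sum_congr rfl fun k hk =>
      (intervalIntegral.integral_congr_ae <| ae_of_all _ fun _ ht =>
        hcell k (Finset.mem_range.1 hk) ht).symm.trans (hval k),
      ← Finset.sum_div, Finset.sum_add_distrib, ← Finset.sum_div,
      Finset.sum_range_sub (fun k : ℕ => ((k : ℝ) + 1) ^ 3)]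
    simp only [Finset.sum_const, Finset.card_range, nsmul_eq_mul]
    push_cast
    field_simp
    ring

end
end

section
/- For every positive integer n, let a_j = (1/2)((2j−1)/(2n) − 1/n) for 1 ≤ j ≤ n. Then ∫_0^{a_1 + a_2 + 1/n} ‖(x,0) − (a_1, a_1 + 1/n)‖² dx + Σ_{i=2}^{n−1} ∫_{a_{i−1} + a_i + 1/n}^{a_i + a_{i+1} + 1/n} ‖(x,0) − (a_i, a_i + 1/n)‖² dx + ∫_{a_{n−1} + a_n + 1/n}^1 ‖(x,0) − (a_n, a_n + 1/n)‖² dx = (4n² + 12n + 13)/(24n²). -/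
open MeasureTheory intervalIntegral

noncomputable section

lemma norm_pt_sub_pt_sq_s13 (x y u v : ℝ) :
    ‖pt x y - pt u v‖ ^ 2 = (x - u) ^ 2 + (y - v) ^ 2 := by
  simp [pt, EuclideanSpace.norm_sq_eq, Fin.sum_univ_two]

lemma integral_norm_pt_sub_pt_sq (l r u v : ℝ) :
    ∫ x in l..r, ‖pt x 0 - pt u v‖ ^ 2 =
      ((r - u) ^ 3 - (l - u) ^ 3) / 3 + (r - l) * v ^ 2 := by
  simp only [norm_pt_sub_pt_sq_s13]
  rw [intervalIntegral.integral_add (Continuous.intervalIntegrable (by fun_prop) _ _)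
    (Continuous.intervalIntegrable (by fun_prop) _ _),
    intervalIntegral.integral_comp_sub_right (fun x => x ^ 2) u, integral_pow,
    intervalIntegral.integral_const, smul_eq_mul]
  norm_num

lemma sum_Icc_quadratic (m : ℕ) :
    ∑ j ∈ Finset.Icc 1 m, (8 * (j : ℝ) ^ 2 + 8 * j + 10 / 3) =
      m * (8 * (m : ℝ) ^ 2 + 24 * m + 26) / 3 := by
  induction m with
  | zero => simp
  | succ k ih =>
    rw [Finset.sum_Icc_succ_top (by omega), ih]
    push_cast
    ring

/-- for a_j = (1/2)((2j−1)/(2n) − 1/n), the total distortion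
∫_0^{a_1+a_2+1/n} ‖(x,0) − (a_1, a_1+1/n)‖² dx
+ Σ_{i=2}^{n−1} ∫_{a_{i−1}+a_i+1/n}^{a_i+a_{i+1}+1/n} ‖(x,0) − (a_i, a_i+1/n)‖² dx
+ ∫_{a_{n−1}+a_n+1/n}^1 ‖(x,0) − (a_n, a_n+1/n)‖² dx
equals (4n² + 12n + 13)/(24n²).  Here the Voronoi partition points are written as
p_0 = 0, p_n = 1 and p_j = a_j + a_{j+1} + 1/n for 0 < j < n, and the displayed sum of
integrals is Σ_{j=1}^{n} ∫_{p_{j−1}}^{p_j} ‖(x,0) − (a_j, a_j + 1/n)‖² dx. -/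
theorem distortion_of_candidate_set (n : ℕ) (hn : 1 ≤ n) :
    letI a : ℕ → ℝ := fun j => (1 / 2) * ((2 * (j : ℝ) - 1) / (2 * n) - 1 / n)
    letI p : ℕ → ℝ := fun j => if j = 0 then 0 else if j = n then 1
      else a j + a (j + 1) + 1 / n
    (∑ j ∈ Finset.Icc 1 n,
        ∫ x in (p (j - 1))..(p j), ‖pt x 0 - pt (a j) (a j + 1 / (n : ℝ))‖ ^ 2) =
      (4 * (n : ℝ) ^ 2 + 12 * n + 13) / (24 * (n : ℝ) ^ 2) := by
  have hn0 : (n : ℝ) ≠ 0 := by positivity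
  have hp : ∀ j : ℕ, (if j = 0 then (0 : ℝ) else if j = n then 1
      else (1 / 2) * ((2 * (j : ℝ) - 1) / (2 * n) - 1 / n) +
        (1 / 2) * ((2 * ((j + 1 : ℕ) : ℝ) - 1) / (2 * n) - 1 / n) + 1 / n) = j / n := by
    intro j
    split_ifs with h0 h1
    · simp [h0]
    · rw [h1, div_self hn0]
    · push_cast
      field_simp
      ring
  simp only [hp, integral_norm_pt_sub_pt_sq]
  have hterm : ∀ j ∈ Finset.Icc 1 n,
      (((j : ℝ) / n - 1 / 2 * ((2 * (j : ℝ) - 1) / (2 * n) - 1 / n)) ^ 3 -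
        (((j - 1 : ℕ) : ℝ) / n - 1 / 2 * ((2 * (j : ℝ) - 1) / (2 * n) - 1 / n)) ^ 3) / 3 +
        ((j : ℝ) / n - ((j - 1 : ℕ) : ℝ) / n) *
          (1 / 2 * ((2 * (j : ℝ) - 1) / (2 * n) - 1 / n) + 1 / n) ^ 2 =
      (8 * (j : ℝ) ^ 2 + 8 * j + 10 / 3) / (16 * (n : ℝ) ^ 3) := by
    intro j hj
    rw [Nat.cast_pred (Finset.mem_Icc.mp hj).1]
    field_simp
    ring
  rw [Finset.sum_congr rfl hterm, ← Finset.sum_div, sum_Icc_quadratic]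
  field_simp
  ring

end
end

section
/- Let μ be the uniform (Lebesgue) probability measure on [0,1]. For every positive integer n, the set {(2j−1)/(2n) : 1 ≤ j ≤ n} is the unique set β ⊆ ℝ with 1 ≤ card(β) ≤ n minimizing ∫_0^1 min_{b∈β} (x − b)² dx, and the minimum value equals 1/(12n²). -/
open MeasureTheory intervalIntegral

noncomputable section

/-- The distortion ∫_0^1 min_{b ∈ β} (x − b)² dx of a finite set β ⊆ ℝ with respect to the
uniform distribution on [0,1]. -/
def distortion1 (β : Finset ℝ) : ℝ :=
  ∫ x in (0 : ℝ)..1, sInf ((fun b => (x - b) ^ 2) '' ↑β)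

/-- The truncated parabola `max 0 (r² - (x - b)²)`. -/
def truncParabola (r b x : ℝ) : ℝ := max 0 (r ^ 2 - (x - b) ^ 2)

lemma continuous_truncParabola (r b : ℝ) : Continuous (truncParabola r b) := by
  unfold truncParabola
  fun_prop

lemma truncParabola_nonneg (r b x : ℝ) : 0 ≤ truncParabola r b x := le_max_left _ _

lemma truncParabola_eq_zero {r b x : ℝ} (hr : 0 ≤ r) (h : r ≤ |x - b|) :
    truncParabola r b x = 0 := by
  refine max_eq_left ?_
  have := pow_le_pow_left₀ hr h 2
  rw [sq_abs] at this
  linarith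

lemma integral_sq_sub_center (b r : ℝ) :
    ∫ x in (b - r)..(b + r), (x - b) ^ 2 = 2 / 3 * r ^ 3 := by
  rw [intervalIntegral.integral_comp_sub_right (fun x => x ^ 2) b, integral_pow]
  norm_num
  ring

lemma integral_truncParabola {r b A B : ℝ} (hr : 0 ≤ r) (hA : A ≤ b - r) (hB : b + r ≤ B) :
    ∫ x in A..B, truncParabola r b x = 4 / 3 * r ^ 3 := by
  have hi : ∀ u v, IntervalIntegrable (truncParabola r b) volume u v := fun u v =>
    (continuous_truncParabola r b).intervalIntegrable u v
  rw [← integral_add_adjacent_intervals (hi A (b - r)) (hi (b - r) B),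
    ← integral_add_adjacent_intervals (hi (b - r) (b + r)) (hi (b + r) B)]
  have h1 : ∫ x in A..(b - r), truncParabola r b x = ∫ x in A..(b - r), (0 : ℝ) := by
    refine integral_congr fun x hx => ?_
    rw [Set.uIcc_of_le hA] at hx
    refine truncParabola_eq_zero hr ?_
    rw [abs_sub_comm]
    exact le_trans (by linarith [hx.2]) (le_abs_self _)
  have h3 : ∫ x in (b + r)..B, truncParabola r b x = ∫ x in (b + r)..B, (0 : ℝ) := by
    refine integral_congr fun x hx => ?_
    rw [Set.uIcc_of_le hB] at hx
    refine truncParabola_eq_zero hr ?_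
    exact le_trans (by linarith [hx.1]) (le_abs_self _)
  have h2 : ∫ x in (b - r)..(b + r), truncParabola r b x
      = ∫ x in (b - r)..(b + r), (r ^ 2 - (x - b) ^ 2) := by
    refine integral_congr fun x hx => ?_
    rw [Set.uIcc_of_le (by linarith)] at hx
    refine max_eq_right ?_
    nlinarith [hx.1, hx.2]
  rw [h1, h2, h3, intervalIntegral.integral_sub (by simp)
    (Continuous.intervalIntegrable (by fun_prop) _ _), integral_sq_sub_center]
  simp
  ring

lemma integral_truncParabola_le {r : ℝ} (hr : 0 ≤ r) (b : ℝ) :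
    ∫ x in (0 : ℝ)..1, truncParabola r b x ≤ 4 / 3 * r ^ 3 := by
  rw [← integral_truncParabola hr (min_le_right 0 (b - r)) (le_max_right 1 (b + r))]
  refine integral_mono_interval (min_le_left _ _) zero_le_one (le_max_left _ _)
    (Filter.Eventually.of_forall fun x => truncParabola_nonneg r b x)
    ((continuous_truncParabola r b).intervalIntegrable _ _)

/-- The squared distance from `x` to the finite set `γ`. -/
def minSqDist (γ : Finset ℝ) (x : ℝ) : ℝ := sInf ((fun b => (x - b) ^ 2) '' ↑γ)

lemma minSqDist_le {γ : Finset ℝ} {b : ℝ} (hb : b ∈ γ) (x : ℝ) :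
    minSqDist γ x ≤ (x - b) ^ 2 :=
  csInf_le (γ.finite_toSet.image _).bddBelow (Set.mem_image_of_mem _ hb)

lemma exists_minSqDist_eq {γ : Finset ℝ} (hγ : γ.Nonempty) (x : ℝ) :
    ∃ b ∈ γ, (x - b) ^ 2 = minSqDist γ x :=
  (hγ.to_set.image fun b => (x - b) ^ 2).csInf_mem (γ.finite_toSet.image _)

lemma continuous_minSqDist {γ : Finset ℝ} (hγ : γ.Nonempty) : Continuous (minSqDist γ) := by
  have h : minSqDist γ = fun x => γ.inf' hγ fun b => (x - b) ^ 2 := by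
    funext x
    exact (Finset.inf'_eq_csInf_image γ hγ _).symm
  rw [h]
  exact Continuous.finset_inf'_apply hγ fun b _ => by fun_prop

lemma excess_nonneg {γ : Finset ℝ} (hγ : γ.Nonempty) (r x : ℝ) :
    0 ≤ minSqDist γ x - r ^ 2 + ∑ b ∈ γ, truncParabola r b x := by
  obtain ⟨b, hb, h⟩ := exists_minSqDist_eq hγ x
  have h1 := Finset.single_le_sum (f := fun b => truncParabola r b x)
    (fun b _ => truncParabola_nonneg r b x) hb
  have h2 : r ^ 2 - (x - b) ^ 2 ≤ truncParabola r b x := le_max_right _ _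
  linarith

lemma continuous_excess {γ : Finset ℝ} (hγ : γ.Nonempty) (r : ℝ) :
    Continuous fun x => minSqDist γ x - r ^ 2 + ∑ b ∈ γ, truncParabola r b x :=
  ((continuous_minSqDist hγ).sub continuous_const).add
    (continuous_finsetSum _ fun b _ => continuous_truncParabola r b)

lemma integral_excess_le {γ : Finset ℝ} (hγ : γ.Nonempty) {r : ℝ} (hr : 0 ≤ r) :
    ∫ x in (0 : ℝ)..1, (minSqDist γ x - r ^ 2 + ∑ b ∈ γ, truncParabola r b x)
      ≤ distortion1 γ - r ^ 2 + γ.card * (4 / 3 * r ^ 3) := by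
  have hm := (continuous_minSqDist hγ).intervalIntegrable (μ := volume) 0 1
  have hp : ∀ b ∈ γ, IntervalIntegrable (truncParabola r b) volume 0 1 := fun b _ =>
    (continuous_truncParabola r b).intervalIntegrable 0 1
  rw [intervalIntegral.integral_add (hm.sub (by simp))
    ((continuous_finsetSum _ fun b _ => continuous_truncParabola r b).intervalIntegrable _ _),
    intervalIntegral.integral_sub hm (by simp), intervalIntegral.integral_finsetSum hp]
  have h := Finset.sum_le_card_nsmul γ (fun b => ∫ x in (0 : ℝ)..1, truncParabola r b x)
    (4 / 3 * r ^ 3) fun b _ => integral_truncParabola_le hr b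
  rw [nsmul_eq_mul] at h
  have hd : ∫ x in (0 : ℝ)..1, minSqDist γ x = distortion1 γ := rfl
  rw [hd]
  simpa using h

lemma card_mul_le {γ : Finset ℝ} {n : ℕ} (hcard : γ.card ≤ n) {r : ℝ} (hr : 0 ≤ r)
    (hrn : 2 * r * n = 1) : γ.card * (4 / 3 * r ^ 3) ≤ 2 / 3 * r ^ 2 := by
  have hc : (γ.card : ℝ) ≤ n := by exact_mod_cast hcard
  calc γ.card * (4 / 3 * r ^ 3) ≤ n * (4 / 3 * r ^ 3) := by gcongr
    _ = 2 / 3 * r ^ 2 * (2 * r * n) := by ring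
    _ = 2 / 3 * r ^ 2 := by rw [hrn, mul_one]

lemma le_distortion1 {γ : Finset ℝ} (hγ : γ.Nonempty) {n : ℕ} (hcard : γ.card ≤ n) {r : ℝ}
    (hr : 0 ≤ r) (hrn : 2 * r * n = 1) : r ^ 2 / 3 ≤ distortion1 γ := by
  have h := integral_excess_le hγ hr
  have h0 := integral_nonneg (μ := volume) zero_le_one
    fun x (_ : x ∈ Set.Icc (0 : ℝ) 1) => excess_nonneg hγ r x
  linarith [card_mul_le hcard hr hrn]

lemma exists_abs_sub_le {γ : Finset ℝ} (hγ : γ.Nonempty) {n : ℕ} (hcard : γ.card ≤ n) {r : ℝ}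
    (hr : 0 ≤ r) (hrn : 2 * r * n = 1) (hd : distortion1 γ ≤ r ^ 2 / 3) {x : ℝ}
    (hx : x ∈ Set.Icc (0 : ℝ) 1) : ∃ b ∈ γ, |x - b| ≤ r := by
  obtain ⟨b, hb, hbx⟩ := exists_minSqDist_eq hγ x
  refine ⟨b, hb, ?_⟩
  by_contra! hlt
  have hsq : r ^ 2 < (x - b) ^ 2 := by
    rw [← sq_abs (x - b)]
    exact pow_lt_pow_left₀ hlt hr two_ne_zero
  have hsum : 0 ≤ ∑ b ∈ γ, truncParabola r b x :=
    Finset.sum_nonneg fun b _ => truncParabola_nonneg r b x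
  have hpos := integral_pos zero_lt_one (continuous_excess hγ r).continuousOn
    (fun x _ => excess_nonneg hγ r x) ⟨x, hx, by linarith⟩
  linarith [integral_excess_le hγ hr, card_mul_le hcard hr hrn]

/-- If the closed `r`-balls around `γ` cover `[0, 1]`, then at least `i` points of `γ` are
at most `(2 * i - 1) * r`. -/
lemma le_card_filter_le {γ : Finset ℝ} {n : ℕ} {r : ℝ} (hr : 0 < r) (hrn : 2 * r * n = 1)
    (hcov : ∀ x ∈ Set.Icc (0 : ℝ) 1, ∃ b ∈ γ, |x - b| ≤ r) (i : ℕ) (hi : i ≤ n) :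
    i ≤ (γ.filter fun b => b ≤ (2 * (i : ℝ) - 1) * r).card := by
  induction i with
  | zero => exact Nat.zero_le _
  | succ i ih =>
    refine (Nat.succ_le_succ (ih (by omega))).trans (Nat.succ_le_of_lt (Finset.card_lt_card ?_))
    have hin : 2 * i * r < 1 := by
      have : (i : ℝ) < n := by exact_mod_cast hi
      nlinarith
    have hev : ∀ᶠ x in nhdsWithin (2 * i * r) (Set.Ioi (2 * i * r)),
        ∀ b ∈ γ.filter (fun b => (2 * i + 1) * r < b), x < b - r := by
      refine (Filter.eventually_all_finset _).2 fun b hb => ?_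
      refine nhdsWithin_le_nhds (eventually_lt_nhds ?_)
      linarith [(Finset.mem_filter.1 hb).2]
    obtain ⟨x, ⟨hx, hx1⟩, hx0⟩ := ((hev.and (nhdsWithin_le_nhds (eventually_lt_nhds hin))).and
      self_mem_nhdsWithin).exists
    have hx0' : 2 * i * r < x := hx0
    obtain ⟨b, hb, hbx⟩ := hcov x ⟨by have : 0 ≤ 2 * i * r := by positivity
                                      linarith, hx1.le⟩
    rw [abs_le] at hbx
    have hble : b ≤ (2 * i + 1) * r := by
      by_contra! hlt
      linarith [hx b (Finset.mem_filter.2 ⟨hb, hlt⟩)]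
    refine (Finset.ssubset_iff_of_subset ?_).2 ⟨b, ?_, ?_⟩
    · refine Finset.monotone_filter_right γ fun c hc => ?_
      push_cast
      intro hc
      linarith
    · rw [Finset.mem_filter]
      push_cast
      exact ⟨hb, by linarith⟩
    · rw [Finset.mem_filter]
      rintro ⟨-, h⟩
      linarith

lemma center_mem {γ : Finset ℝ} {n : ℕ} {r : ℝ} (hr : 0 < r) (hrn : 2 * r * n = 1)
    (hcard : γ.card ≤ n) (hcov : ∀ x ∈ Set.Icc (0 : ℝ) 1, ∃ b ∈ γ, |x - b| ≤ r)
    {j : ℕ} (hj : j ∈ Finset.Icc 1 n) : (2 * (j : ℝ) - 1) * r ∈ γ := by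
  rw [Finset.mem_Icc] at hj
  have hleft := le_card_filter_le hr hrn hcov j hj.2
  have hcov' : ∀ x ∈ Set.Icc (0 : ℝ) 1, ∃ b ∈ γ.image (fun b => 1 - b), |x - b| ≤ r := by
    intro x hx
    obtain ⟨b, hb, hbx⟩ := hcov (1 - x) ⟨by linarith [hx.2], by linarith [hx.1]⟩
    refine ⟨1 - b, Finset.mem_image_of_mem _ hb, ?_⟩
    rwa [abs_sub_comm, show 1 - b - x = 1 - x - b by ring]
  have hright := le_card_filter_le hr hrn hcov' (n + 1 - j) (by omega)
  rw [Finset.filter_image] at hright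
  replace hright := hright.trans Finset.card_image_le
  have hnj : ((n + 1 - j : ℕ) : ℝ) = n + 1 - j := by
    rw [Nat.cast_sub (by omega)]
    push_cast
    ring
  rw [hnj] at hright
  by_contra hmem
  have hdisj : Disjoint (γ.filter fun b => b ≤ (2 * (j : ℝ) - 1) * r)
      (γ.filter fun b => 1 - b ≤ (2 * ((n : ℝ) + 1 - j) - 1) * r) := by
    rw [Finset.disjoint_filter]
    intro b hb h1 h2
    refine hmem ?_
    rwa [← le_antisymm h1 (by linarith)]
  have hunion := Finset.card_le_card (Finset.union_subset
    (Finset.filter_subset (fun b => b ≤ (2 * (j : ℝ) - 1) * r) γ)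
    (Finset.filter_subset (fun b => 1 - b ≤ (2 * ((n : ℝ) + 1 - j) - 1) * r) γ))
  rw [Finset.card_union_of_disjoint hdisj] at hunion
  omega

lemma distortion1_le_of_center_mem {γ : Finset ℝ} (hγ : γ.Nonempty) {n : ℕ} {r : ℝ} (hr : 0 < r)
    (hrn : 2 * r * n = 1) (hmem : ∀ j ∈ Finset.Icc 1 n, (2 * (j : ℝ) - 1) * r ∈ γ) :
    distortion1 γ ≤ r ^ 2 / 3 := by
  have hint : ∀ u v, IntervalIntegrable (minSqDist γ) volume u v := fun u v =>
    (continuous_minSqDist hγ).intervalIntegrable u v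
  have hsplit := sum_integral_adjacent_intervals (a := fun i : ℕ => 2 * r * i) (n := n)
    fun k _ => hint (2 * r * k) (2 * r * (k + 1 : ℕ))
  simp only [hrn, Nat.cast_zero, mul_zero] at hsplit
  have hd : distortion1 γ = ∫ x in (0 : ℝ)..1, minSqDist γ x := rfl
  rw [hd, ← hsplit]
  have hpiece : ∀ k ∈ Finset.range n,
      ∫ x in (2 * r * k)..(2 * r * (k + 1 : ℕ)), minSqDist γ x ≤ 2 / 3 * r ^ 3 := by
    intro k hk
    have hc := hmem (k + 1) (by rw [Finset.mem_range] at hk; rw [Finset.mem_Icc]; omega)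
    rw [← integral_sq_sub_center ((2 * ((k + 1 : ℕ) : ℝ) - 1) * r) r]
    have e1 : (2 * ((k + 1 : ℕ) : ℝ) - 1) * r - r = 2 * r * k := by push_cast; ring
    have e2 : (2 * ((k + 1 : ℕ) : ℝ) - 1) * r + r = 2 * r * (k + 1 : ℕ) := by push_cast; ring
    rw [e1, e2]
    refine integral_mono_on (by gcongr; omega) (hint _ _)
      (Continuous.intervalIntegrable (by fun_prop) _ _) fun x _ => minSqDist_le hc x
  refine (Finset.sum_le_card_nsmul _ _ _ hpiece).trans (le_of_eq ?_)
  rw [Finset.card_range, nsmul_eq_mul]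
  linear_combination r ^ 2 / 3 * hrn

/-- for the uniform distribution on [0,1], the set {(2j−1)/(2n) : 1 ≤ j ≤ n} is
the unique set β ⊆ ℝ with 1 ≤ card(β) ≤ n minimizing ∫_0^1 min_{b∈β} (x − b)² dx, and the
minimum value equals 1/(12n²). -/
theorem optimal_n_means_uniform (n : ℕ) (hn : 1 ≤ n) :
    letI β : Finset ℝ := (Finset.Icc 1 n).image (fun j : ℕ => (2 * (j : ℝ) - 1) / (2 * n))
    (1 ≤ β.card ∧ β.card ≤ n) ∧
    distortion1 β = 1 / (12 * (n : ℝ) ^ 2) ∧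
    (∀ γ : Finset ℝ, 1 ≤ γ.card → γ.card ≤ n → distortion1 β ≤ distortion1 γ) ∧
    (∀ γ : Finset ℝ, 1 ≤ γ.card → γ.card ≤ n →
      (∀ δ : Finset ℝ, 1 ≤ δ.card → δ.card ≤ n → distortion1 γ ≤ distortion1 δ) → γ = β) := by
  have hn0 : (0 : ℝ) < n := by exact_mod_cast hn
  set r : ℝ := 1 / (2 * n) with hrdef
  have hr : 0 < r := by positivity
  have hrn : 2 * r * n = 1 := by
    rw [hrdef]
    field_simp
  have hval : 1 / (12 * (n : ℝ) ^ 2) = r ^ 2 / 3 := by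
    rw [hrdef]
    field_simp
    norm_num
  have hfun : (fun j : ℕ => (2 * (j : ℝ) - 1) / (2 * n)) = fun j : ℕ => (2 * (j : ℝ) - 1) * r := by
    funext j
    rw [hrdef]
    ring
  rw [hfun, hval]
  set β : Finset ℝ := (Finset.Icc 1 n).image (fun j : ℕ => (2 * (j : ℝ) - 1) * r) with hβ
  have hinj : Function.Injective fun j : ℕ => (2 * (j : ℝ) - 1) * r := by
    intro i j hij
    have := mul_right_cancel₀ hr.ne' hij
    exact_mod_cast (by linarith : (i : ℝ) = j)
  have hcard : β.card = n := by
    rw [hβ, Finset.card_image_of_injective _ hinj, Nat.card_Icc, Nat.add_sub_cancel]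
  have hne : ∀ {γ : Finset ℝ}, 1 ≤ γ.card → γ.Nonempty := Finset.card_pos.1
  have hle : distortion1 β ≤ r ^ 2 / 3 :=
    distortion1_le_of_center_mem (hne (hcard ▸ hn)) hr hrn fun j hj =>
      Finset.mem_image_of_mem _ hj
  refine ⟨⟨hcard ▸ hn, hcard.le⟩,
    hle.antisymm (le_distortion1 (hne (hcard ▸ hn)) hcard.le hr.le hrn),
    fun γ h1 h2 => hle.trans (le_distortion1 (hne h1) h2 hr.le hrn), fun γ h1 h2 hmin => ?_⟩
  have hd := (hmin β (hcard ▸ hn) hcard.le).trans hle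
  refine (Finset.eq_of_subset_of_card_le (Finset.image_subset_iff.2 fun j hj => ?_)
    (h2.trans hcard.ge)).symm
  exact center_mem hr hrn h2 (fun x hx => exists_abs_sub_le (hne h1) h2 hr.le hrn hd hx) hj


end
end
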